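/- arXiv:math/0301040 — 2 statements merged into one kernel-verified Lean document; each statement's English description precedes it below -/
import Mathlib

section
/- Let (M,f) be a symmetric bilinear lattice, V = M ⊗ ℚ, M^♯ = {x ∈ V : f_ℚ(x, M) ⊆ ℤ} the dual lattice, G_f = M^♯/M, and L_f : G_f × G_f → ℚ/ℤ the induced pairing L_f([x],[y]) = f_ℚ(x,y) mod ℤ. Then the radical Ker(L̂_f) equals (M + Ker(f̂_ℚ))/M, and this is isomorphic to (Ker f̂) ⊗ ℚ/ℤ. In particular, L_f is nondegenerate if and only if f is nondegenerate. -/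
/-- The dual lattice `M^♯ = {x ∈ V : F(x, M) ⊆ ℤ}`. -/
def dualLattice {V : Type*} [AddCommGroup V] [Module ℚ V]
    (F : V →ₗ[ℚ] V →ₗ[ℚ] ℚ) (M : Submodule ℤ V) : Submodule ℤ V where
  carrier := {x | ∀ m ∈ M, ∃ n : ℤ, (n : ℚ) = F x m}
  add_mem' := by
    intro x y hx hy m hm
    obtain ⟨a, ha⟩ := hx m hm
    obtain ⟨b, hb⟩ := hy m hm
    exact ⟨a + b, by push_cast; simp [ha, hb]⟩
  zero_mem' := by
    intro m hm
    exact ⟨0, by simp⟩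
  smul_mem' := by
    intro k x hx m hm
    obtain ⟨a, ha⟩ := hx m hm
    refine ⟨k * a, ?_⟩
    push_cast
    rw [ha]
    simp

theorem exists_zsmul_mem_of_mem_span_rat {W : Type*} [AddCommGroup W] [Module ℚ W]
    (N : Submodule ℤ W) {x : W} (hx : x ∈ Submodule.span ℚ (N : Set W)) :
    ∃ n : ℤ, n ≠ 0 ∧ n • x ∈ N := by
  induction hx using Submodule.span_induction with
  | mem x hx => exact ⟨1, one_ne_zero, by simpa using hx⟩
  | zero => exact ⟨1, one_ne_zero, by simp⟩
  | add x y _ _ hx hy =>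
    obtain ⟨a, ha, hax⟩ := hx
    obtain ⟨b, hb, hby⟩ := hy
    refine ⟨a * b, mul_ne_zero ha hb, ?_⟩
    rw [smul_add, mul_smul a b y, mul_comm a b, mul_smul b a x]
    exact N.add_mem (N.smul_mem b hax) (N.smul_mem a hby)
  | smul q x _ hx =>
    obtain ⟨a, ha, hax⟩ := hx
    refine ⟨q.den * a, mul_ne_zero (by exact_mod_cast q.den_nz) ha, ?_⟩
    have key : ((q.den * a : ℤ)) • q • x = q.num • a • x := by
      simp only [← Int.cast_smul_eq_zsmul ℚ, smul_smul]
      congr 1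
      push_cast
      rw [← Rat.den_mul_eq_num]
      ring
    rw [key]
    exact N.smul_mem _ hax

/-- A finitely generated subgroup of a rational vector space has a finite `ℤ`-basis which is
linearly independent over `ℚ`. -/
theorem exists_basis_linearIndependent_rat {W : Type*} [AddCommGroup W] [Module ℚ W]
    (N : Submodule ℤ W) (hN : N.FG) :
    ∃ (r : ℕ) (b : Module.Basis (Fin r) ℤ N), LinearIndependent ℚ fun i => (b i : W) := by
  have : Module.Finite ℤ N := Module.Finite.iff_fg.mpr hN
  have : IsAddTorsionFree W := .of_module_rat W
  let b := Module.finBasis ℤ N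
  refine ⟨_, b, ?_⟩
  rw [← LinearIndependent.iff_fractionRing ℤ ℚ]
  exact b.linearIndependent.map' N.subtype N.ker_subtype

theorem sum_repr_smul_coe_of_basis {W : Type*} [AddCommGroup W] [Module ℚ W]
    {N : Submodule ℤ W} {r : ℕ} (b : Module.Basis (Fin r) ℤ N) (x : N) :
    ∑ i, (b.repr x i : ℚ) • (b i : W) = x := by
  have := congrArg N.subtype (b.sum_repr x)
  simp only [map_sum, map_smul, Submodule.subtype_apply] at this
  simpa only [Int.cast_smul_eq_zsmul] using this

theorem sum_smul_mem_iff_of_basis {W : Type*} [AddCommGroup W] [Module ℚ W]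
    {N : Submodule ℤ W} {r : ℕ} (b : Module.Basis (Fin r) ℤ N)
    (hb : LinearIndependent ℚ fun i => (b i : W)) (c : Fin r → ℚ) :
    ∑ i, c i • (b i : W) ∈ N ↔ ∀ i, ∃ n : ℤ, (n : ℚ) = c i := by
  constructor
  · intro h i
    exact ⟨b.repr ⟨_, h⟩ i, hb.eq_coords_of_eq (sum_repr_smul_coe_of_basis b ⟨_, h⟩) i⟩
  · intro h
    choose n hn using h
    refine N.sum_mem fun i _ => ?_
    rw [← hn i, Int.cast_smul_eq_zsmul]
    exact N.smul_mem _ (b i).2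

theorem exists_sum_smul_eq_of_mem_span {W : Type*} [AddCommGroup W] [Module ℚ W]
    {N : Submodule ℤ W} {r : ℕ} (b : Module.Basis (Fin r) ℤ N)
    {x : W} (hx : x ∈ Submodule.span ℚ (N : Set W)) :
    ∃ c : Fin r → ℚ, ∑ i, c i • (b i : W) = x := by
  obtain ⟨n, hn, hnx⟩ := exists_zsmul_mem_of_mem_span_rat N hx
  refine ⟨fun i => (n : ℚ)⁻¹ * b.repr ⟨_, hnx⟩ i, ?_⟩
  simp only [mul_smul, ← Finset.smul_sum, sum_repr_smul_coe_of_basis]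
  rw [← Int.cast_smul_eq_zsmul ℚ, inv_smul_smul₀ (by exact_mod_cast hn)]

/-- A functional which is integral wherever a finitely generated group `A` of functionals is
integral lies in `A`, provided it lies in the rational span of `A`. -/
theorem mem_of_integral_on_dual {V : Type*} [AddCommGroup V] [Module ℚ V]
    (A : Submodule ℤ (Module.Dual ℚ V)) (hA : A.FG) {φ : Module.Dual ℚ V}
    (hφ : φ ∈ Submodule.span ℚ (A : Set (Module.Dual ℚ V)))
    (h : ∀ y, (∀ a ∈ A, ∃ n : ℤ, (n : ℚ) = a y) → ∃ n : ℤ, (n : ℚ) = φ y) : φ ∈ A := by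
  obtain ⟨r, b, hb⟩ := exists_basis_linearIndependent_rat A hA
  obtain ⟨c, rfl⟩ := exists_sum_smul_eq_of_mem_span b hφ
  rw [sum_smul_mem_iff_of_basis b hb]
  intro j
  obtain ⟨y, hy⟩ : ∃ y : V, ∀ i, (b i : Module.Dual ℚ V) y = (Pi.single j 1 : Fin r → ℚ) i := by
    have hli : LinearIndependent ℚ fun i => ⇑(b i : Module.Dual ℚ V) :=
      hb.map' (LinearMap.ltoFun ℚ V ℚ ℚ) (LinearMap.ker_eq_bot.mpr DFunLike.coe_injective)
    let ev : V →ₗ[ℚ] Fin r → ℚ := LinearMap.pi fun i => (b i : Module.Dual ℚ V)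
    have hev : LinearMap.range ev = ⊤ := by
      rw [← Submodule.span_eq (LinearMap.range ev), LinearMap.coe_range]
      exact span_flip_eq_top_iff_linearIndependent.mpr hli
    obtain ⟨y, hy⟩ := LinearMap.range_eq_top.mp hev (Pi.single j 1)
    exact ⟨y, congrFun hy⟩
  obtain ⟨n, hn⟩ := h y fun a ha => by
    refine ⟨b.repr ⟨a, ha⟩ j, ?_⟩
    have := LinearMap.congr_fun (sum_repr_smul_coe_of_basis b ⟨a, ha⟩) y
    simpa [hy, Pi.single_apply] using this
  exact ⟨n, by simpa [hy, Pi.single_apply] using hn⟩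

/-- A finitely generated subgroup of a rational vector space contains no nonzero subspace. -/
theorem eq_bot_of_restrictScalars_le_of_fg {W : Type*} [AddCommGroup W] [Module ℚ W]
    (N : Submodule ℤ W) (hN : N.FG) (K : Submodule ℚ W) (hK : K.restrictScalars ℤ ≤ N) :
    K = ⊥ := by
  obtain ⟨r, b, hb⟩ := exists_basis_linearIndependent_rat N hN
  rw [eq_bot_iff]
  intro x hx
  have hdiv : ∀ i, b.repr ⟨x, hK hx⟩ i = 0 := by
    intro i
    set m := b.repr ⟨x, hK hx⟩ i
    have hk : ((|m| + 1 : ℤ) : ℚ) ≠ 0 := by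
      have : |m| + 1 ≠ 0 := by positivity
      exact_mod_cast this
    have hy : ((|m| + 1 : ℤ) : ℚ)⁻¹ • x ∈ N := hK (K.smul_mem _ hx)
    have hxy : (⟨x, hK hx⟩ : N) = (|m| + 1) • ⟨_, hy⟩ := by
      ext
      simp only [Submodule.coe_smul]
      rw [← Int.cast_smul_eq_zsmul ℚ, smul_inv_smul₀ hk]
    have hd : |m| + 1 ∣ m := ⟨b.repr ⟨_, hy⟩ i, by
      simpa only [map_smul, Finsupp.smul_apply, smul_eq_mul] using
        congrArg (fun z => b.repr z i) hxy⟩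
    exact Int.eq_zero_of_abs_lt_dvd hd (by omega)
  have : (⟨x, hK hx⟩ : N) = 0 := b.repr.injective (by ext i; simp [hdiv i])
  simpa using congrArg Subtype.val this

open scoped TensorProduct in
theorem nonempty_sup_quotient_addEquiv_tensorProduct {V : Type*} [AddCommGroup V] [Module ℚ V]
    (M : Submodule ℤ V) (hspan : Submodule.span ℚ (M : Set V) = ⊤) (hfg : M.FG)
    (K : Submodule ℚ V) :
    Nonempty
        ((↥(M ⊔ K.restrictScalars ℤ) ⧸ (M.comap (M ⊔ K.restrictScalars ℤ).subtype)) ≃+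
          (↥(M ⊓ K.restrictScalars ℤ) ⊗[ℤ] AddCircle (1 : ℚ))) := by
  have hNfg : (M ⊓ K.restrictScalars ℤ).FG := by
    have : IsNoetherian ℤ M := isNoetherian_of_fg_of_noetherian M hfg
    exact Submodule.FG.of_le hfg inf_le_left
  obtain ⟨r, b, hb⟩ := exists_basis_linearIndependent_rat _ hNfg
  have hK : ∀ c : Fin r → ℚ, ∑ i, c i • (b i : V) ∈ K := fun c =>
    K.sum_mem fun i _ => K.smul_mem _ (b i).2.2
  let g : (Fin r → ℚ) →+
      (↥(M ⊔ K.restrictScalars ℤ) ⧸ (M.comap (M ⊔ K.restrictScalars ℤ).subtype)) :=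
    (Submodule.mkQ _).toAddMonoidHom.comp
      { toFun := fun c => ⟨∑ i, c i • (b i : V), Submodule.mem_sup_right (hK c)⟩
        map_zero' := by ext; simp
        map_add' := fun c d => by ext; simp [add_smul, Finset.sum_add_distrib] }
  have hg : Function.Surjective g := by
    intro z
    obtain ⟨⟨z, hz⟩, rfl⟩ := Submodule.mkQ_surjective _ z
    obtain ⟨m, hm, k, hk, rfl⟩ := Submodule.mem_sup.mp hz
    have hkN : k ∈ Submodule.span ℚ ((M ⊓ K.restrictScalars ℤ : Submodule ℤ V) : Set V) := by
      obtain ⟨n, hn, hnk⟩ := exists_zsmul_mem_of_mem_span_rat M (x := k) (by simp [hspan])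
      have hn' : (n : ℚ) ≠ 0 := by exact_mod_cast hn
      rw [← inv_smul_smul₀ hn' k, Int.cast_smul_eq_zsmul]
      exact Submodule.smul_mem _ _
        (Submodule.subset_span ⟨hnk, (K.restrictScalars ℤ).smul_mem n hk⟩)
    obtain ⟨c, hc⟩ := exists_sum_smul_eq_of_mem_span b hkN
    refine ⟨c, (Submodule.Quotient.eq _).mpr ?_⟩
    simpa [hc] using hm
  let h : (Fin r → ℚ) →+ (Fin r → AddCircle (1 : ℚ)) :=
    { toFun := fun c i => (c i : AddCircle (1 : ℚ))
      map_zero' := by ext; simp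
      map_add' := fun c d => by ext; simp }
  have hh : Function.Surjective h := by
    intro z
    choose c hc using fun i => QuotientAddGroup.mk_surjective (z i)
    exact ⟨c, funext hc⟩
  have hker : g.ker = h.ker := by
    ext c
    have h1 : g c = 0 ↔ ∑ i, c i • (b i : V) ∈ M := Submodule.Quotient.mk_eq_zero _
    have h2 : ∑ i, c i • (b i : V) ∈ M ↔ ∑ i, c i • (b i : V) ∈ M ⊓ K.restrictScalars ℤ :=
      ⟨fun hm => ⟨hm, hK c⟩, fun hm => hm.1⟩
    rw [AddMonoidHom.mem_ker, AddMonoidHom.mem_ker, h1, h2, sum_smul_mem_iff_of_basis b hb,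
      funext_iff]
    refine forall_congr' fun i => ?_
    change _ ↔ (c i : AddCircle (1 : ℚ)) = 0
    rw [AddCircle.coe_eq_zero_iff]
    simp
  exact ⟨(QuotientAddGroup.quotientKerEquivOfSurjective g hg).symm.trans <|
    (QuotientAddGroup.quotientAddEquivOfEq hker).trans <|
    (QuotientAddGroup.quotientKerEquivOfSurjective h hh).trans <|
    (Finsupp.linearEquivFunOnFinite ℤ _ _).symm.toAddEquiv.trans
      (TensorProduct.equivFinsuppOfBasisLeft b).symm.toAddEquiv⟩

open scoped TensorProduct in
/-- The radical of the discriminant pairing `L_f` on `G_f = M^♯/M` equals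
`(M + Ker f̂_ℚ)/M`, this group is isomorphic to `(Ker f̂) ⊗ ℚ/ℤ`, and `L_f` is
nondegenerate iff `f` is nondegenerate. -/
theorem stmt7 {V : Type*} [AddCommGroup V] [Module ℚ V] [FiniteDimensional ℚ V]
    (F : V →ₗ[ℚ] V →ₗ[ℚ] ℚ) (hsymm : ∀ x y : V, F x y = F y x)
    (M : Submodule ℤ V) (hspan : Submodule.span ℚ (M : Set V) = ⊤) (hfg : M.FG)
    (hint : ∀ x ∈ M, ∀ y ∈ M, ∃ n : ℤ, (n : ℚ) = F x y) :
    (∀ x ∈ dualLattice F M,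
      ((∀ y ∈ dualLattice F M, ∃ n : ℤ, (n : ℚ) = F x y) ↔
        x ∈ M ⊔ (LinearMap.ker F).restrictScalars ℤ))
    ∧ Nonempty
        ((↥(M ⊔ (LinearMap.ker F).restrictScalars ℤ) ⧸
            (M.comap (M ⊔ (LinearMap.ker F).restrictScalars ℤ).subtype)) ≃+
          (↥(M ⊓ (LinearMap.ker F).restrictScalars ℤ) ⊗[ℤ] AddCircle (1 : ℚ)))
    ∧ ((∀ x ∈ dualLattice F M,
          (∀ y ∈ dualLattice F M, ∃ n : ℤ, (n : ℚ) = F x y) → x ∈ M)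
        ↔ (∀ x ∈ M, (∀ y ∈ M, F x y = 0) → x = 0)) := by
  have hKdual : ∀ x y, x ∈ LinearMap.ker F → F x y = 0 ∧ F y x = 0 := fun x y hx => by
    rw [hsymm y x, LinearMap.mem_ker.mp hx]
    simp
  have hrad : ∀ x ∈ dualLattice F M,
      ((∀ y ∈ dualLattice F M, ∃ n : ℤ, (n : ℚ) = F x y) ↔
        x ∈ M ⊔ (LinearMap.ker F).restrictScalars ℤ) := by
    intro x _
    constructor
    · intro h
      have hspan' : F x ∈
          Submodule.span ℚ (M.map (F.restrictScalars ℤ) : Set (Module.Dual ℚ V)) := by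
        rw [Submodule.map_coe, LinearMap.coe_restrictScalars, Submodule.span_image, hspan]
        exact ⟨x, trivial, rfl⟩
      obtain ⟨m, hm, hmx⟩ := mem_of_integral_on_dual _ (hfg.map (F.restrictScalars ℤ)) hspan'
        fun y hy => h y fun m hm => by
          rw [hsymm]
          exact hy _ ⟨m, hm, rfl⟩
      refine Submodule.mem_sup.mpr ⟨m, hm, x - m, ?_, by abel⟩
      simpa [sub_eq_zero] using hmx.symm
    · intro h y hy
      obtain ⟨m, hm, k, hk, rfl⟩ := Submodule.mem_sup.mp h
      obtain ⟨n, hn⟩ := hy m hm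
      exact ⟨n, by rw [hn, map_add, LinearMap.add_apply, (hKdual k y hk).1, add_zero, hsymm]⟩
  have hker_mem : ∀ x ∈ LinearMap.ker F, x ∈ dualLattice F M := fun x hx m _ =>
    ⟨0, by simp [(hKdual x m hx).1]⟩
  refine ⟨hrad, nonempty_sup_quotient_addEquiv_tensorProduct M hspan hfg _, fun h x hx hx0 => ?_,
    fun h x hx hxint => ?_⟩
  · have hbot : LinearMap.ker F = ⊥ := eq_bot_of_restrictScalars_le_of_fg M hfg _ fun k hk =>
      h k (hker_mem k hk) ((hrad k (hker_mem k hk)).mpr (Submodule.mem_sup_right hk))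
    have hxker : F x = 0 := LinearMap.ext_on hspan fun y hy => by simpa using hx0 y hy
    exact (Submodule.eq_bot_iff _).mp hbot x hxker
  · obtain ⟨m, hm, k, hk, rfl⟩ := Submodule.mem_sup.mp ((hrad x hx).mp hxint)
    obtain ⟨n, hn, hnk⟩ := exists_zsmul_mem_of_mem_span_rat M (x := k) (by simp [hspan])
    have hnk0 : n • k = 0 := h _ hnk fun y _ =>
      (hKdual _ y (((LinearMap.ker F).restrictScalars ℤ).smul_mem n hk)).1
    have : IsAddTorsionFree V := .of_module_rat V
    rw [(smul_eq_zero.mp hnk0).resolve_left hn, add_zero]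
    exact hm
end

section
/- Let (M,f) be a symmetric bilinear lattice. The pairing ⟨−,−⟩ : Coker(f̂) × G_f → ℚ/ℤ induced by (α, x) ↦ α_ℚ(x) mod ℤ is left nondegenerate and right nonsingular; moreover it is left nonsingular if and only if f is nondegenerate. -/
/-- The subgroup of `Hom_ℚ(V,ℚ)` of forms which are integer-valued on `M`;
since `M` spans `V`, it is identified with `M* = Hom(M,ℤ)`. -/
def intForms {V : Type*} [AddCommGroup V] [Module ℚ V] (M : Submodule ℤ V) :
    Submodule ℤ (V →ₗ[ℚ] ℚ) where
  carrier := {a | ∀ m ∈ M, ∃ n : ℤ, (n : ℚ) = a m}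
  add_mem' := by
    intro x y hx hy m hm
    obtain ⟨a, ha⟩ := hx m hm
    obtain ⟨b, hb⟩ := hy m hm
    exact ⟨a + b, by push_cast; simp [ha, hb]⟩
  zero_mem' := by
    intro m hm
    exact ⟨0, by simp⟩
  smul_mem' := by
    intro k x hx m hm
    obtain ⟨a, ha⟩ := hx m hm
    refine ⟨k * a, ?_⟩
    push_cast
    rw [ha]
    simp

/-- A finitely generated subgroup of a rational vector space is generated by a finite family
which is linearly independent over `ℚ`. -/
theorem exists_linearIndependent_span_int_eq {W : Type*} [AddCommGroup W] [Module ℚ W]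
    (L : Submodule ℤ W) (hL : L.FG) :
    ∃ (n : ℕ) (e : Fin n → W), LinearIndependent ℚ e ∧
      Submodule.span ℤ (Set.range e) = L := by
  have : Module.Finite ℤ L := Module.Finite.iff_fg.mpr hL
  have : IsAddTorsionFree W := IsAddTorsionFree.of_module_rat W
  obtain ⟨n, b⟩ := Module.basisOfFiniteTypeTorsionFree' (R := ℤ) (M := L)
  refine ⟨n, fun i => (b i : W), ?_, ?_⟩
  · have h : LinearIndependent ℤ (fun i => (b i : W)) :=
      b.linearIndependent.map' L.subtype (Submodule.ker_subtype L)
    exact (LinearIndependent.iff_fractionRing ℤ ℚ).mp h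
  · have h := congrArg (Submodule.map L.subtype) b.span_eq
    rw [Submodule.map_span, Submodule.map_top, Submodule.range_subtype, ← Set.range_comp] at h
    exact h

/-- A rational number all of whose rational multiples are integers is zero. -/
theorem eq_zero_of_forall_mul_int {q : ℚ} (h : ∀ c : ℚ, ∃ n : ℤ, (n : ℚ) = c * q) : q = 0 := by
  by_contra hq
  obtain ⟨n, hn⟩ := h (q⁻¹ / 2)
  have h2 : (n : ℚ) * 2 = 1 := by rw [hn]; field_simp
  have h3 : n * 2 = 1 := by exact_mod_cast h2
  omega

/-- Each coordinate with respect to a linearly independent family extends to a linear form. -/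
theorem LinearIndependent.exists_coordinate_form {K W ι : Type*} [Field K] [AddCommGroup W]
    [Module K W] [DecidableEq ι] {e : ι → W} (he : LinearIndependent K e) (i : ι) :
    ∃ φ : W →ₗ[K] K, ∀ j, φ (e j) = if j = i then 1 else 0 := by
  obtain ⟨φ, hφ⟩ := LinearMap.exists_extend ((Finsupp.lapply i).comp he.repr)
  refine ⟨φ, fun j => ?_⟩
  have h := LinearMap.congr_fun hφ ⟨e j, Submodule.subset_span (Set.mem_range_self j)⟩
  have h2 := he.repr_eq_single j ⟨e j, Submodule.subset_span (Set.mem_range_self j)⟩ rfl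
  refine h.trans ?_
  simp [h2, Finsupp.single_apply]

/-- A finitely generated subgroup of a rational vector space is its own
double dual. -/
theorem mem_of_forall_integral {W : Type*} [AddCommGroup W] [Module ℚ W]
    (L : Submodule ℤ W) (hL : L.FG) (w : W)
    (hw : ∀ φ ∈ intForms L, ∃ n : ℤ, (n : ℚ) = φ w) : w ∈ L := by
  obtain ⟨n, e, he, rfl⟩ := exists_linearIndependent_span_int_eq L hL
  have hspan : w ∈ Submodule.span ℚ (Set.range e) := by
    by_contra hne
    obtain ⟨φ, hφw, hφ⟩ := Submodule.exists_le_ker_of_notMem hne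
    refine hφw (eq_zero_of_forall_mul_int fun c => ?_)
    refine hw (c • φ) fun m hm => ⟨0, ?_⟩
    have : φ m = 0 := hφ (Submodule.span_le_restrictScalars ℤ ℚ _ hm)
    simp [this]
  obtain ⟨c, rfl⟩ := (Submodule.mem_span_range_iff_exists_fun ℚ).mp hspan
  refine Submodule.sum_mem _ fun i _ => ?_
  obtain ⟨φ, hφe⟩ := he.exists_coordinate_form i
  obtain ⟨k, hk⟩ := hw φ fun m hm => by
    obtain ⟨d, rfl⟩ := (Submodule.mem_span_range_iff_exists_fun ℤ).mp hm
    refine ⟨d i, ?_⟩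
    simp [hφe]
  have hci : (k : ℚ) = c i := by simpa [hφe] using hk
  rw [← hci, Int.cast_smul_eq_zsmul]
  exact Submodule.smul_mem _ k (Submodule.subset_span (Set.mem_range_self i))

/-- A character of a full lattice with values in `ℚ/ℤ` lifts to a rational linear form. -/
theorem exists_linearMap_lift {W : Type*} [AddCommGroup W] [Module ℚ W] {ι : Type*} [Fintype ι]
    (b : Module.Basis ι ℚ W) (L : Submodule ℤ W) (hb : ∀ i, b i ∈ L)
    (hL : ∀ x ∈ L, ∀ i, ∃ n : ℤ, (n : ℚ) = b.repr x i) (h : L →+ AddCircle (1 : ℚ)) :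
    ∃ a : W →ₗ[ℚ] ℚ, ∀ x : L, h x = ((a (x : W) : ℚ) : AddCircle (1 : ℚ)) := by
  choose q hq using fun i => QuotientAddGroup.mk_surjective (h ⟨b i, hb i⟩)
  refine ⟨b.constr ℚ q, fun x => ?_⟩
  choose n hn using hL x x.2
  have hx : (x : W) = ∑ i, n i • b i := by
    conv_lhs => rw [← b.sum_repr (x : W)]
    exact Finset.sum_congr rfl fun i _ => by rw [← hn, Int.cast_smul_eq_zsmul]
  have hxL : x = ∑ i, n i • (⟨b i, hb i⟩ : L) := Subtype.ext (by simpa using hx)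
  rw [hx, map_sum, hxL, map_sum]
  simp only [map_zsmul, Module.Basis.constr_basis, ← hq]
  exact (map_sum (QuotientAddGroup.mk' (AddSubgroup.zmultiples (1 : ℚ)))
    (fun i => n i • q i) Finset.univ).symm

/-- The class in `ℚ/ℤ` of a rational number is zero iff the number is an integer. -/
theorem coe_addCircle_one_eq_zero_iff (q : ℚ) :
    (q : AddCircle (1 : ℚ)) = 0 ↔ ∃ n : ℤ, (n : ℚ) = q := by
  rw [AddCircle.coe_eq_zero_iff]
  simp

/-- An integer divisible by every power of a non-unit is zero. -/
theorem Int.eq_zero_of_forall_pow_dvd {p : ℤ} (hp : 1 < p.natAbs) {z : ℤ}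
    (h : ∀ k : ℕ, p ^ k ∣ z) : z = 0 := by
  by_contra hz
  exact (Int.finiteMultiplicity_iff.mpr ⟨by omega, hz⟩).elim fun k hk => hk (h (k + 1))

/-- If the form has a nonzero radical vector `r` in `M`, some character of `M^♯/M` is not
induced by an integral form. -/
theorem exists_character_not_intForm {V : Type*} [AddCommGroup V] [Module ℚ V]
    (F : V →ₗ[ℚ] V →ₗ[ℚ] ℚ) (M : Submodule ℤ V) (hfg : M.FG)
    (r : V) (hr : r ∈ M) (hr0 : r ≠ 0) (hrad : ∀ y ∈ M, F r y = 0) :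
    ∃ h : ↥(dualLattice F M) →+ AddCircle (1 : ℚ),
      (∀ x : ↥(dualLattice F M), (x : V) ∈ M → h x = 0) ∧
      ¬ ∃ a ∈ intForms M, ∀ x : ↥(dualLattice F M),
        h x = ((a (x : V) : ℚ) : AddCircle (1 : ℚ)) := by
  have hdual : ∀ c : ℚ, c • r ∈ dualLattice F M := fun c y hy => ⟨0, by simp [hrad y hy]⟩
  obtain ⟨φ, hφ, hφr⟩ : ∃ φ ∈ intForms M, φ r ≠ 0 := by
    by_contra! hall
    obtain ⟨n, e, he, rfl⟩ := exists_linearIndependent_span_int_eq M hfg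
    obtain ⟨d, rfl⟩ := (Submodule.mem_span_range_iff_exists_fun ℤ).mp hr
    refine hr0 (Finset.sum_eq_zero fun i _ => ?_)
    obtain ⟨φ, hφe⟩ := he.exists_coordinate_form i
    have h0 := hall φ fun m hm => by
      obtain ⟨d, rfl⟩ := (Submodule.mem_span_range_iff_exists_fun ℤ).mp hm
      exact ⟨d i, by simp [hφe]⟩
    have hd : d i = 0 := by simpa [hφe] using h0
    rw [hd, zero_smul]
  obtain ⟨z, hz⟩ := hφ r hr
  let N : Submodule ℤ (dualLattice F M) :=
    { carrier := {x | ∃ k : ℕ, (3 ^ k : ℤ) • (x : V) ∈ M}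
      add_mem' := by
        rintro x y ⟨j, hj⟩ ⟨k, hk⟩
        refine ⟨j + k, ?_⟩
        have : (3 ^ (j + k) : ℤ) • ((x + y : dualLattice F M) : V) =
            (3 ^ k : ℤ) • ((3 ^ j : ℤ) • (x : V)) + (3 ^ j : ℤ) • ((3 ^ k : ℤ) • (y : V)) := by
          rw [smul_smul, smul_smul, pow_add, mul_comm (3 ^ k : ℤ), ← smul_add]
          rfl
        rw [this]
        exact M.add_mem (M.smul_mem _ hj) (M.smul_mem _ hk)
      zero_mem' := ⟨0, by simp⟩
      smul_mem' := by
        rintro c x ⟨k, hk⟩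
        refine ⟨k, ?_⟩
        have : (3 ^ k : ℤ) • ((c • x : dualLattice F M) : V) = c • ((3 ^ k : ℤ) • (x : V)) :=
          smul_comm _ _ _
        rw [this]
        exact M.smul_mem _ hk }
  obtain ⟨k, hk⟩ : ∃ k : ℕ, (⟨(2 ^ k : ℚ)⁻¹ • r, hdual _⟩ : dualLattice F M) ∉ N := by
    by_contra! hall
    have hz0 : z = 0 := Int.eq_zero_of_forall_pow_dvd (p := 2) (by norm_num) fun k => by
      obtain ⟨j, hj⟩ := hall k
      obtain ⟨m, hm⟩ := hφ _ hj
      have hm' : (m : ℚ) = 3 ^ j * ((2 ^ k)⁻¹ * z) := by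
        rw [hm, map_zsmul, map_smul, ← hz]; simp
      have h2 : (2 ^ k * m : ℚ) = 3 ^ j * z := by rw [hm']; field_simp
      have h3 : (2 ^ k * m : ℤ) = 3 ^ j * z := by exact_mod_cast h2
      have hcop : IsCoprime ((2 : ℤ) ^ k) (3 ^ j) :=
        IsCoprime.pow (Int.isCoprime_iff_gcd_eq_one.mpr (by norm_num))
      exact hcop.dvd_of_dvd_mul_left ⟨m, h3.symm⟩
    exact hφr (by rw [← hz, hz0, Int.cast_zero])
  obtain ⟨c, hc⟩ := CharacterModule.exists_character_apply_ne_zero_of_ne_zero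
    (A := dualLattice F M ⧸ N) (a := N.mkQ ⟨(2 ^ k : ℚ)⁻¹ • r, hdual _⟩)
    (by simpa using hk)
  have hN : ∀ x ∈ N, c (N.mkQ x) = 0 := fun x hx => by
    have h : N.mkQ x = 0 := (Submodule.Quotient.mk_eq_zero N).mpr hx
    rw [h, map_zero]
  refine ⟨AddMonoidHom.comp c N.mkQ.toAddMonoidHom, fun x hx => hN x ⟨0, by simpa using hx⟩, ?_⟩
  rintro ⟨a, ha, hax⟩
  have hca : ∀ x : dualLattice F M, c (N.mkQ x) = ((a (x : V) : ℚ) : AddCircle (1 : ℚ)) := hax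
  obtain ⟨s, hs⟩ := ha r hr
  have hs0 : s = 0 := Int.eq_zero_of_forall_pow_dvd (p := 3) (by norm_num) fun j => by
    have h0 := hN ⟨(3 ^ j : ℚ)⁻¹ • r, hdual _⟩ ⟨j, by
      have : (3 ^ j : ℤ) • ((3 ^ j : ℚ)⁻¹ • r) = r := by
        rw [← Int.cast_smul_eq_zsmul ℚ, smul_smul]
        simp
      simpa only [this] using hr⟩
    rw [hca, coe_addCircle_one_eq_zero_iff] at h0
    obtain ⟨m, hm⟩ := h0
    have hm' : (m : ℚ) = (3 ^ j)⁻¹ * s := by rw [hm, map_smul, ← hs]; simp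
    have h2 : (s : ℚ) = 3 ^ j * m := by rw [hm']; field_simp
    exact ⟨m, by exact_mod_cast h2⟩
  refine hc ?_
  rw [hca, map_smul, ← hs, hs0]
  simp

/-- The pairing `⟨−,−⟩ : Coker f̂ × G_f → ℚ/ℤ` induced by `(α, x) ↦ α_ℚ(x)` is
left nondegenerate and right nonsingular, and left nonsingular iff `f` is
nondegenerate. Here `Coker f̂` is represented by integral forms modulo `f̂(M)`,
and `G_f` by `M^♯` modulo `M`. -/
theorem stmt14 {V : Type*} [AddCommGroup V] [Module ℚ V] [FiniteDimensional ℚ V]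
    (F : V →ₗ[ℚ] V →ₗ[ℚ] ℚ) (hsymm : ∀ x y : V, F x y = F y x)
    (M : Submodule ℤ V) (hspan : Submodule.span ℚ (M : Set V) = ⊤) (hfg : M.FG)
    (hint : ∀ x ∈ M, ∀ y ∈ M, ∃ n : ℤ, (n : ℚ) = F x y) :
    -- left nondegenerate
    (∀ a ∈ intForms M, (∀ x ∈ dualLattice F M, ∃ n : ℤ, (n : ℚ) = a x) →
        ∃ m ∈ M, a = F m)
    -- left nonsingular iff f nondegenerate
    ∧ (((∀ a ∈ intForms M, (∀ x ∈ dualLattice F M, ∃ n : ℤ, (n : ℚ) = a x) →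
            ∃ m ∈ M, a = F m)
        ∧ ∀ h : ↥(dualLattice F M) →+ AddCircle (1 : ℚ),
            (∀ x : ↥(dualLattice F M), (x : V) ∈ M → h x = 0) →
            ∃ a ∈ intForms M, ∀ x : ↥(dualLattice F M),
              h x = ((a (x : V) : ℚ) : AddCircle (1 : ℚ)))
        ↔ (∀ x ∈ M, (∀ y ∈ M, F x y = 0) → x = 0))
    -- right injective
    ∧ (∀ x ∈ dualLattice F M,
        (∀ a ∈ intForms M, ∃ n : ℤ, (n : ℚ) = a x) → x ∈ M)
    -- right surjective
    ∧ ∀ φ : ↥(intForms M) →+ AddCircle (1 : ℚ),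
        (∀ a : ↥(intForms M), (∃ m ∈ M, (a : V →ₗ[ℚ] ℚ) = F m) → φ a = 0) →
        ∃ x ∈ dualLattice F M, ∀ a : ↥(intForms M),
          φ a = (((a : V →ₗ[ℚ] ℚ) x : ℚ) : AddCircle (1 : ℚ)) := by
  classical
  obtain ⟨n, e, he, hM⟩ := exists_linearIndependent_span_int_eq M hfg
  have hspan' : ⊤ ≤ Submodule.span ℚ (Set.range e) := by
    rw [← hspan, ← hM]
    exact Submodule.span_le.mpr (Submodule.span_le_restrictScalars ℤ ℚ _)
  let b : Module.Basis (Fin n) ℚ V := Module.Basis.mk he hspan'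
  have hbM : ∀ i, b i ∈ M := fun i => by
    rw [← hM, Module.Basis.mk_apply]
    exact Submodule.subset_span (Set.mem_range_self i)
  have hbint : ∀ a : V →ₗ[ℚ] ℚ, (∀ i, ∃ n : ℤ, (n : ℚ) = a (b i)) → a ∈ intForms M := by
    intro a ha m hm
    rw [← hM] at hm
    obtain ⟨d, rfl⟩ := (Submodule.mem_span_range_iff_exists_fun ℤ).mp hm
    choose k hk using ha
    refine ⟨∑ i, d i * k i, ?_⟩
    push_cast
    simp [hk, b]
  have hleft : ∀ a ∈ intForms M, (∀ x ∈ dualLattice F M, ∃ n : ℤ, (n : ℚ) = a x) →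
      ∃ m ∈ M, a = F m := by
    intro a _ hax
    have h : a ∈ M.map (F.restrictScalars ℤ) := by
      refine mem_of_forall_integral _ (hfg.map _) a fun φ hφ => ?_
      obtain ⟨x, rfl⟩ := (Module.evalEquiv ℚ V).surjective φ
      refine hax x fun m hm => ?_
      rw [hsymm]
      exact hφ (F m) ⟨m, hm, rfl⟩
    obtain ⟨m, hm, rfl⟩ := h
    exact ⟨m, hm, rfl⟩
  refine ⟨hleft, ⟨?_, ?_⟩, ?_, ?_⟩
  · rintro ⟨-, hsurj⟩ r hr hrad
    by_contra hr0
    obtain ⟨h, hhM, hh⟩ := exists_character_not_intForm F M hfg r hr hr0 hrad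
    exact hh (hsurj h hhM)
  · refine fun hnd => ⟨hleft, fun h hhM => ?_⟩
    have hinj : Function.Injective F := by
      rw [← LinearMap.ker_eq_bot, Submodule.eq_bot_iff]
      intro x hx
      obtain ⟨⟨k, hk⟩, hkint⟩ := IsLocalization.exist_integer_multiples_of_finite
        (nonZeroDivisors ℤ) (fun i => b.repr x i)
      choose d hd using hkint
      have hkx : k • x ∈ M := by
        conv => rw [← b.sum_repr x, Finset.smul_sum]
        refine M.sum_mem fun i _ => ?_
        rw [← smul_assoc, ← hd i]
        simpa [Int.cast_smul_eq_zsmul] using M.smul_mem (d i) (hbM i)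
      have h0 : k • x = 0 := hnd _ hkx fun y _ => by
        rw [map_zsmul, LinearMap.mem_ker.mp hx, smul_zero, LinearMap.zero_apply]
      rw [← Int.cast_smul_eq_zsmul ℚ] at h0
      exact (smul_eq_zero.mp h0).resolve_left
        (Int.cast_ne_zero.mpr (nonZeroDivisors.ne_zero hk))
    let E : V ≃ₗ[ℚ] Module.Dual ℚ V :=
      LinearMap.linearEquivOfInjective F hinj Subspace.dual_finrank_eq.symm
    have hE : ∀ x, E x = F x := fun x => rfl
    obtain ⟨a, ha⟩ := exists_linearMap_lift (b.dualBasis.map E.symm) (dualLattice F M)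
      (fun i => by
        refine hbint (F _) fun j => ⟨if i = j then 1 else 0, ?_⟩
        rw [← hE, Module.Basis.map_apply, LinearEquiv.apply_symm_apply]
        simp [Finsupp.single_apply, eq_comm])
      (fun x hx i => by
        simpa [hE] using hx (b i) (hbM i)) h
    refine ⟨a, fun m hm => ?_, ha⟩
    rw [← coe_addCircle_one_eq_zero_iff, ← ha ⟨m, hint m hm⟩]
    exact hhM _ hm
  · exact fun x _ hx => mem_of_forall_integral M hfg x hx
  · intro φ hφ
    obtain ⟨ψ, hψ⟩ := exists_linearMap_lift b.dualBasis (intForms M)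
      (fun i => hbint _ fun j => ⟨if j = i then 1 else 0, by
        simp [Finsupp.single_apply]⟩)
      (fun a ha i => by simpa using ha (b i) (hbM i)) φ
    obtain ⟨x, rfl⟩ := (Module.evalEquiv ℚ V).surjective ψ
    refine ⟨x, fun m hm => ?_, hψ⟩
    rw [hsymm, ← coe_addCircle_one_eq_zero_iff]
    exact (hψ ⟨F m, hint m hm⟩).symm.trans (hφ _ ⟨m, hm, rfl⟩)
end
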